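/- If M is a locally compact Hausdorff MT-algebra, then M is regular; moreover, M is spatial, i.e., the underlying complete Boolean algebra of M is atomic (every nonzero element has an atom below it). -/

import Mathlib

/-- An MT-algebra: a complete Boolean algebra with an interior operator. -/
structure MTAlg (M : Type*) [CompleteBooleanAlgebra M] where
  box : M → M
  box_top : box ⊤ = ⊤
  box_inf : ∀ a b : M, box (a ⊓ b) = box a ⊓ box b
  box_le : ∀ a : M, box a ≤ a
  box_idem : ∀ a : M, box a ≤ box (box a)

namespace MTAlg

variable {M : Type*} [CompleteBooleanAlgebra M] (T : MTAlg M)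

/-- The closure (dual) operator. -/
def dia (a : M) : M := (T.box aᶜ)ᶜ

/-- Open elements. -/
def IsOpenElem (a : M) : Prop := T.box a = a

/-- Closed elements. -/
def IsClosedElem (a : M) : Prop := T.dia a = a

/-- Saturated elements: meets of open elements. -/
def IsSaturatedElem (a : M) : Prop :=
  ∃ S : Set M, (∀ s ∈ S, T.IsOpenElem s) ∧ a = sInf S

/-- Weakly locally closed elements: meets of a saturated and a closed element. -/
def IsWLC (a : M) : Prop :=
  ∃ s c : M, T.IsSaturatedElem s ∧ T.IsClosedElem c ∧ a = s ⊓ c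

/-- T0-algebras: every element is a join of weakly locally closed elements. -/
def IsT0 : Prop :=
  ∀ a : M, ∃ S : Set M, (∀ b ∈ S, T.IsWLC b) ∧ a = sSup S

/-- T1-algebras: every element is a join of closed elements. -/
def IsT1 : Prop :=
  ∀ a : M, ∃ S : Set M, (∀ b ∈ S, T.IsClosedElem b) ∧ a = sSup S

/-- Join-irreducible elements of the lattice of closed elements. -/
def JoinIrredClosed (p : M) : Prop :=
  T.IsClosedElem p ∧ p ≠ ⊥ ∧
    ∀ a b : M, T.IsClosedElem a → T.IsClosedElem b → p = a ⊔ b → p = a ∨ p = b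

/-- Sober MT-algebras. -/
def Sober : Prop :=
  T.IsT0 ∧ ∀ p : M, T.JoinIrredClosed p → ∃ x : M, IsAtom x ∧ p = T.dia x

/-- Filters of the underlying lattice. -/
def IsFilter (F : Set M) : Prop :=
  ⊤ ∈ F ∧ (∀ a b : M, a ∈ F → a ≤ b → b ∈ F) ∧ (∀ a b : M, a ∈ F → b ∈ F → a ⊓ b ∈ F)

/-- Open filters. -/
def IsOpenFilter (F : Set M) : Prop :=
  IsFilter F ∧ ∀ a ∈ F, T.box a ∈ F

/-- Scott-open filters. -/
def IsScottOpenFilter (F : Set M) : Prop :=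
  T.IsOpenFilter F ∧
    ∀ S : Set M, (∀ s ∈ S, T.IsOpenElem s) → S.Nonempty → DirectedOn (· ≤ ·) S →
      sSup S ∈ F → ∃ s ∈ S, s ∈ F

/-- Compact elements. -/
def IsCompactElem (a : M) : Prop :=
  ∀ S : Set M, (∀ s ∈ S, T.IsOpenElem s) → a ≤ sSup S →
    ∃ t ⊆ S, t.Finite ∧ a ≤ sSup t

/-- The relation `a ◁ b`: there is a compact element between `a` and `b`. -/
def Triangle (a b : M) : Prop := ∃ k : M, T.IsCompactElem k ∧ a ≤ k ∧ k ≤ b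

/-- Locally compact MT-algebras. -/
def LocallyCompact : Prop :=
  ∀ u : M, T.IsOpenElem u → u = sSup {v : M | T.IsOpenElem v ∧ T.Triangle v u}

/-- The way-below relation in the frame of open elements. -/
def WayBelowOpen (a b : M) : Prop :=
  ∀ S : Set M, (∀ s ∈ S, T.IsOpenElem s) → b ≤ sSup S →
    ∃ t ⊆ S, t.Finite ∧ a ≤ sSup t

/-- Elements approximated from above by regular closed elements. -/
def GC (a : M) : Prop :=
  a = sInf {b : M | ∃ c : M, a ≤ T.box c ∧ b = T.dia (T.box c)}

/-- Hausdorff MT-algebras. -/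
def IsHausdorff : Prop :=
  ∀ a : M, ∃ S : Set M, (∀ b ∈ S, T.GC b) ∧ a = sSup S

/-- Regular MT-algebras. -/
def IsRegular : Prop :=
  T.IsT1 ∧ ∀ a : M, T.IsOpenElem a →
    a = sSup {b : M | T.IsOpenElem b ∧ T.dia b ≤ a}

end MTAlg

/-- The atom space of a complete Boolean algebra. -/
abbrev AtomSpace (M : Type*) [CompleteBooleanAlgebra M] : Type _ := {x : M // IsAtom x}

/-- The set of atoms below an element. -/
def eta {M : Type*} [CompleteBooleanAlgebra M] (a : M) : Set (AtomSpace M) :=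
  {x : AtomSpace M | x.1 ≤ a}

namespace MTAlg

variable {M : Type*} [CompleteBooleanAlgebra M] (T : MTAlg M)

/-- The topology on the atom space, generated by the images of open elements. -/
def atTop : TopologicalSpace (AtomSpace M) :=
  TopologicalSpace.generateFrom {U : Set (AtomSpace M) | ∃ u : M, T.IsOpenElem u ∧ U = eta u}

end MTAlg

namespace MTAlg

variable {M : Type*} [CompleteBooleanAlgebra M] (T : MTAlg M)

theorem box_mono {a b : M} (h : a ≤ b) : T.box a ≤ T.box b := by
  have := T.box_inf a b
  rw [inf_eq_left.2 h] at this
  exact inf_eq_left.1 this.symm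

theorem isOpenElem_box (a : M) : T.IsOpenElem (T.box a) :=
  le_antisymm (T.box_le _) (T.box_idem a)

theorem le_dia (a : M) : a ≤ T.dia a :=
  le_compl_comm.1 (T.box_le aᶜ)

theorem dia_mono {a b : M} (h : a ≤ b) : T.dia a ≤ T.dia b :=
  compl_le_compl (T.box_mono (compl_le_compl h))

variable {T}

theorem isClosedElem_iff_isOpenElem_compl {a : M} : T.IsClosedElem a ↔ T.IsOpenElem aᶜ := by
  unfold IsClosedElem IsOpenElem dia
  rw [compl_eq_comm, eq_comm]

theorem isClosedElem_dia (a : M) : T.IsClosedElem (T.dia a) := by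
  rw [isClosedElem_iff_isOpenElem_compl, dia, compl_compl]
  exact T.isOpenElem_box _

theorem isClosedElem_sInf {S : Set M} (h : ∀ s ∈ S, T.IsClosedElem s) :
    T.IsClosedElem (sInf S) :=
  le_antisymm (le_sInf fun s hs => (T.dia_mono (sInf_le hs)).trans_eq (h s hs)) (T.le_dia _)

theorem IsClosedElem.inf {a b : M} (ha : T.IsClosedElem a) (hb : T.IsClosedElem b) :
    T.IsClosedElem (a ⊓ b) := by
  rw [← sInf_pair]
  exact isClosedElem_sInf (by simp [ha, hb])

theorem IsOpenElem.inf {a b : M} (ha : T.IsOpenElem a) (hb : T.IsOpenElem b) :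
    T.IsOpenElem (a ⊓ b) := by
  rw [IsOpenElem, T.box_inf, ha, hb]

theorem IsOpenElem.disjoint_dia {u a : M} (hu : T.IsOpenElem u) (h : Disjoint u a) :
    Disjoint u (T.dia a) := by
  rw [dia, disjoint_compl_right_iff, ← hu]
  exact T.box_mono h.le_compl_right

theorem GC.isClosedElem {a : M} (h : T.GC a) : T.IsClosedElem a := by
  rw [GC] at h
  rw [h]
  exact isClosedElem_sInf (by rintro _ ⟨c, -, rfl⟩; exact isClosedElem_dia _)

theorem IsHausdorff.isT1 (h : T.IsHausdorff) : T.IsT1 := fun a =>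
  let ⟨S, hS, ha⟩ := h a
  ⟨S, fun b hb => (hS b hb).isClosedElem, ha⟩

/-- If `P` holds on a join-dense set, every nonzero element bounds a nonzero element of `P`. -/
theorem exists_ne_bot_le_of_joinDense {P : M → Prop}
    (h : ∀ a : M, ∃ S : Set M, (∀ b ∈ S, P b) ∧ a = sSup S) {a : M} (ha : a ≠ ⊥) :
    ∃ b ≤ a, P b ∧ b ≠ ⊥ := by
  obtain ⟨S, hS, rfl⟩ := h a
  by_contra! hne
  exact ha (sSup_eq_bot.2 fun b hb => hne b (le_sSup hb) (hS b hb))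

theorem exists_isOpenElem_disjoint_sSup {b : M} {t : Set M} (ht : t.Finite)
    (h : ∀ s ∈ t, ∃ u, T.IsOpenElem u ∧ b ≤ u ∧ Disjoint u s) :
    ∃ u, T.IsOpenElem u ∧ b ≤ u ∧ Disjoint u (sSup t) := by
  induction t, ht using Set.Finite.induction_on with
  | empty => exact ⟨⊤, T.box_top, le_top, by simp⟩
  | insert _ _ ih =>
    obtain ⟨u, hu, hbu, hut⟩ := ih fun s hs => h s (Set.mem_insert_of_mem _ hs)
    obtain ⟨v, hv, hbv, hvs⟩ := h _ (Set.mem_insert _ _)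
    refine ⟨u ⊓ v, hu.inf hv, le_inf hbu hbv, ?_⟩
    rw [sSup_insert, disjoint_sup_right]
    exact ⟨hvs.mono_left inf_le_right, hut.mono_left inf_le_left⟩

theorem IsCompactElem.disjoint_dia_of_gc {k b : M} (hk : T.IsCompactElem k) (hb : T.GC b)
    (h : Disjoint b k) : Disjoint b (T.dia k) := by
  have hcover : k ≤ sSup (compl '' {d : M | ∃ c : M, b ≤ T.box c ∧ d = T.dia (T.box c)}) := by
    rw [← compl_sInf', ← hb]
    exact h.le_compl_left
  obtain ⟨t, htS, ht, hkt⟩ := hk _ (by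
    rintro _ ⟨_, ⟨c, -, rfl⟩, rfl⟩
    exact isClosedElem_iff_isOpenElem_compl.1 (isClosedElem_dia _)) hcover
  obtain ⟨u, hu, hbu, hut⟩ := exists_isOpenElem_disjoint_sSup (T := T) (b := b) ht (by
    intro s hs
    obtain ⟨_, ⟨c, hbc, rfl⟩, rfl⟩ := htS hs
    exact ⟨T.box c, T.isOpenElem_box c, hbc, disjoint_compl_right_iff.2 (T.le_dia _)⟩)
  exact (hu.disjoint_dia (hut.mono_right hkt)).mono_left hbu

theorem IsCompactElem.isClosedElem {k : M} (hT2 : T.IsHausdorff) (hk : T.IsCompactElem k) :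
    T.IsClosedElem k := by
  refine le_antisymm ?_ (T.le_dia k)
  rw [← sdiff_eq_bot_iff]
  by_contra hne
  obtain ⟨b, hba, hb, hb0⟩ := exists_ne_bot_le_of_joinDense hT2 hne
  have hbk : Disjoint b k := disjoint_sdiff_self_left.mono_left hba
  exact hb0 ((hk.disjoint_dia_of_gc hb hbk).eq_bot_of_le (hba.trans sdiff_le))

theorem LocallyCompact.isRegular (hlc : T.LocallyCompact) (hT2 : T.IsHausdorff) :
    T.IsRegular := by
  refine ⟨hT2.isT1, fun u hu => le_antisymm ?_ (sSup_le fun b hb => (T.le_dia b).trans hb.2)⟩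
  conv_lhs => rw [hlc u hu]
  refine sSup_le_sSup ?_
  rintro v ⟨hv, k, hk, hvk, hku⟩
  exact ⟨hv, ((T.dia_mono hvk).trans_eq (hk.isClosedElem hT2)).trans hku⟩

theorem IsCompactElem.inf_isClosedElem {k c : M} (hk : T.IsCompactElem k)
    (hc : T.IsClosedElem c) : T.IsCompactElem (k ⊓ c) := by
  intro S hS hle
  obtain ⟨t, htS, ht, hkt⟩ := hk (insert cᶜ S)
    (by
      rintro s (rfl | hs)
      exacts [isClosedElem_iff_isOpenElem_compl.1 hc, hS s hs])
    (by rwa [sSup_insert, sup_comm, ← sdiff_le_iff', sdiff_compl])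
  refine ⟨t \ {cᶜ}, by grind, ht.sdiff, ?_⟩
  rw [← sdiff_compl, sdiff_le_iff', sup_comm, ← sSup_insert]
  exact hkt.trans (sSup_le_sSup (by grind))

theorem IsCompactElem.sInf_ne_bot_of_isChain {b : M} (hb : T.IsCompactElem b) {C : Set M}
    (hC : IsChain (· ≤ ·) C) (hne : C.Nonempty)
    (hclosed : ∀ c ∈ C, T.IsClosedElem c ∧ c ≠ ⊥ ∧ c ≤ b) : sInf C ≠ ⊥ := by
  intro hbot
  obtain ⟨t, htC, ht, hbt⟩ := hb (compl '' C)
    (by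
      rintro _ ⟨c, hc, rfl⟩
      exact isClosedElem_iff_isOpenElem_compl.1 (hclosed c hc).1)
    (by rw [← compl_sInf', hbot, compl_bot]; exact le_top)
  obtain ⟨c, hc, hle⟩ : ∃ c ∈ C, sSup t ≤ cᶜ := by
    clear hbt
    induction t, ht using Set.Finite.induction_on with
    | empty => exact ⟨hne.some, hne.some_mem, by simp⟩
    | insert _ _ ih =>
      obtain ⟨c, hc, hle⟩ := ih ((Set.subset_insert _ _).trans htC)
      obtain ⟨d, hd, rfl⟩ := htC (Set.mem_insert _ _)
      rw [sSup_insert]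
      rcases hC.total hc hd with h | h
      · exact ⟨c, hc, sup_le (compl_le_compl h) hle⟩
      · exact ⟨d, hd, sup_le le_rfl (hle.trans (compl_le_compl h))⟩
  obtain ⟨-, hc0, hcb⟩ := hclosed c hc
  exact hc0 (le_compl_self.1 (hcb.trans (hbt.trans hle)))

theorem IsCompactElem.exists_isAtom_le {b : M} (hT1 : T.IsT1) (hb : T.IsCompactElem b)
    (hbc : T.IsClosedElem b) (hb0 : b ≠ ⊥) : ∃ a, IsAtom a ∧ a ≤ b := by
  obtain ⟨m, ⟨-, hm0, hmb⟩, hmin⟩ :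
      ∃ m, Minimal (fun c => T.IsClosedElem c ∧ c ≠ ⊥ ∧ c ≤ b) m := by
    obtain ⟨m, -, hm, hmax⟩ := zorn_le_nonempty₀ (α := Mᵒᵈ)
      {c : M | T.IsClosedElem c ∧ c ≠ ⊥ ∧ c ≤ b}
      (fun C hCs hC y hy => ⟨sInf (α := M) C,
        ⟨isClosedElem_sInf fun c hc => (hCs hc).1,
          hb.sInf_ne_bot_of_isChain hC.symm ⟨y, hy⟩ fun c hc => hCs hc,
          (sInf_le (α := M) hy).trans (hCs hy).2.2⟩,
        fun c hc => sInf_le (α := M) hc⟩)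
      b ⟨hbc, hb0, le_rfl⟩
    exact ⟨m, hm, fun c hc hcm => hmax hc hcm⟩
  refine ⟨m, ⟨hm0, fun x hx => ?_⟩, hmb⟩
  by_contra hx0
  obtain ⟨c, hcx, hc, hc0⟩ := exists_ne_bot_le_of_joinDense hT1 hx0
  have hmc : m ≤ c := hmin ⟨hc, hc0, (hcx.trans hx.le).trans hmb⟩ (hcx.trans hx.le)
  exact hx.not_ge (hmc.trans hcx)

theorem LocallyCompact.isAtomic (hlc : T.LocallyCompact) (hT2 : T.IsHausdorff) :
    IsAtomic M := by
  refine ⟨fun a => or_iff_not_imp_left.2 fun ha => ?_⟩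
  obtain ⟨c, hca, hc, hc0⟩ := exists_ne_bot_le_of_joinDense hT2.isT1 ha
  obtain ⟨k, hk, hkc⟩ : ∃ k, T.IsCompactElem k ∧ k ⊓ c ≠ ⊥ := by
    by_contra! h
    refine hc0 (disjoint_top.1 ?_)
    rw [hlc ⊤ T.box_top, disjoint_sSup_iff]
    rintro v ⟨-, k, hk, hvk, -⟩
    exact (disjoint_iff.2 (h k hk)).symm.mono_right hvk
  obtain ⟨x, hx, hxk⟩ := (hk.inf_isClosedElem hc).exists_isAtom_le hT2.isT1
    ((hk.isClosedElem hT2).inf hc) hkc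
  exact ⟨x, hx, hxk.trans (inf_le_right.trans hca)⟩

end MTAlg

/-- Every locally compact Hausdorff MT-algebra is regular, and moreover spatial
(its underlying complete Boolean algebra is atomic). -/
theorem regular_and_spatial_of_locallyCompact_hausdorff {M : Type*}
    [CompleteBooleanAlgebra M] (T : MTAlg M)
    (hlc : T.LocallyCompact) (hT2 : T.IsHausdorff) :
    T.IsRegular ∧ IsAtomic M := by
  exact ⟨hlc.isRegular hT2, hlc.isAtomic hT2⟩
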